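/- For any a ≠ 0, the initial value problem for equation (E) with w(0) = a, w'(0) = 0 admits a unique solution w in C¹([0,∞)) such that |w'|^{p-2}w' belongs to C¹([0,∞)); moreover this solution satisfies lim_{r→0⁺} |w'(r)|^{p-2}w'(r)/r = -(|a|^{q-1}a + α a)/N and |w(r)| ≤ |a| for all r ∈ [0,∞). -/

import Mathlib

open Set Filter Topology Asymptotics

/-- The p-Laplacian nonlinearity φ_p(x) = |x|^{p-2} x. -/
noncomputable def phiP (p x : ℝ) : ℝ := |x| ^ (p - 2) * x

/-- `w` is a solution of equation (E) on the interval `I ⊆ (0,∞)`: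
`w` is C¹ on `I`, `|w'|^{p-2} w'` is C¹ on `I`, and the equation
`(|w'|^{p-2}w')' + ((N-1)/r)|w'|^{p-2}w' + r w' + α w + |w|^{q-1} w = 0`
holds on `I` (derivatives taken within `I`). -/
def IsSolutionOn (N : ℕ) (p q α : ℝ) (w : ℝ → ℝ) (I : Set ℝ) : Prop :=
  ContDiffOn ℝ 1 w I ∧
  ContDiffOn ℝ 1 (fun r => phiP p (derivWithin w I r)) I ∧
  ∀ r ∈ I,
    derivWithin (fun s => phiP p (derivWithin w I s)) I r
      + ((N : ℝ) - 1) / r * phiP p (derivWithin w I r)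
      + r * derivWithin w I r + α * w r + |w r| ^ (q - 1) * w r = 0

/-- `w` is the global solution of (E) on `[0,∞)` with `w(0) = a`, `w'(0) = 0`:
`w ∈ C¹([0,∞))`, `|w'|^{p-2}w' ∈ C¹([0,∞))`, and (E) holds on `(0,∞)`. -/
def IsGlobalSolution (N : ℕ) (p q α a : ℝ) (w : ℝ → ℝ) : Prop :=
  ContDiffOn ℝ 1 w (Ici 0) ∧
  ContDiffOn ℝ 1 (fun r => phiP p (derivWithin w (Ici 0) r)) (Ici 0) ∧
  (∀ r ∈ Ioi (0 : ℝ),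
    derivWithin (fun s => phiP p (derivWithin w (Ici 0) s)) (Ici 0) r
      + ((N : ℝ) - 1) / r * phiP p (derivWithin w (Ici 0) r)
      + r * derivWithin w (Ici 0) r + α * w r + |w r| ^ (q - 1) * w r = 0) ∧
  w 0 = a ∧ derivWithin w (Ici 0) 0 = 0

/-- `r` is an isolated zero of `w` relative to the set `I`. -/
def IsIsolatedZeroOn (w : ℝ → ℝ) (I : Set ℝ) (r : ℝ) : Prop :=
  r ∈ I ∧ w r = 0 ∧ ∀ᶠ s in 𝓝[I \ {r}] r, w s ≠ 0

/-- `w` has at least `n` isolated zeros in `(0,∞)`. -/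
def HasAtLeastIsolatedZeros (w : ℝ → ℝ) (n : ℕ) : Prop :=
  ∃ z : Fin n → ℝ, StrictMono z ∧ ∀ i, 0 < z i ∧ IsIsolatedZeroOn w (Ici 0) (z i)

theorem exists_pointwise_convergent_subseq (x : ℕ → ℝ → ℝ) (a : ℝ) (C : ℝ → ℝ)
    (h0 : ∀ n, x n 0 = a)
    (hC : ∀ R n r s, r ≤ R → s ≤ R → |x n r - x n s| ≤ C R * |r - s|) :
    ∃ φ : ℕ → ℕ, StrictMono φ ∧ ∃ w : ℝ → ℝ,
      ∀ r, Tendsto (fun n => x (φ n) r) atTop (𝓝 (w r)) := by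
  have hK : IsCompact (Set.pi univ fun t : ℚ =>
      Metric.closedBall a (C (max (t : ℝ) 0) * |(t : ℝ)|)) :=
    isCompact_univ_pi fun t => isCompact_closedBall _ _
  obtain ⟨y, -, φ, hφ, hy⟩ := hK.tendsto_subseq (x := fun n (t : ℚ) => x n t) (by
    intro n t _
    rw [Metric.mem_closedBall, Real.dist_eq]
    simpa [h0] using hC (max (t : ℝ) 0) n t 0 (le_max_left _ _) (le_max_right _ _))
  refine ⟨φ, hφ, ?_⟩
  rw [tendsto_pi_nhds] at hy
  have key : ∀ r, ∃ l, Tendsto (fun n => x (φ n) r) atTop (𝓝 l) := by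
    intro r
    refine cauchySeq_tendsto_of_complete (Metric.cauchySeq_iff'.2 fun ε hε => ?_)
    set D := |C (r + 1)| + 1
    have hD : 0 < D := by positivity
    obtain ⟨t, hrt, htr⟩ := exists_rat_btwn (show r < r + min 1 (ε / (4 * D)) by
      have : 0 < min 1 (ε / (4 * D)) := by positivity
      linarith)
    have h1 : (t : ℝ) ≤ r + 1 := by linarith [min_le_left 1 (ε / (4 * D))]
    have h2 : (t : ℝ) - r < ε / (4 * D) := by linarith [min_le_right 1 (ε / (4 * D))]
    have hclose : ∀ n, |x n r - x n t| ≤ ε / 4 := by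
      intro n
      refine (hC (r + 1) n r t (by linarith) h1).trans ?_
      have h3 : |r - t| ≤ ε / (4 * D) := by rw [abs_sub_comm, abs_of_pos] <;> linarith
      calc C (r + 1) * |r - t| ≤ D * (ε / (4 * D)) := by
            gcongr
            exact (le_abs_self _).trans (by simp [D])
        _ = ε / 4 := by field_simp
    obtain ⟨n₀, hn₀⟩ := Metric.cauchySeq_iff'.1 (hy t).cauchySeq (ε / 4) (by positivity)
    refine ⟨n₀, fun n hn => ?_⟩
    have h4 := hn₀ n hn
    simp only [Function.comp_apply, Real.dist_eq] at h4 ⊢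
    have h5 := hclose (φ n)
    have h6 := hclose (φ n₀)
    rw [abs_le] at h5 h6
    rw [abs_lt] at h4 ⊢
    constructor <;> linarith
  choose w hw using key
  exact ⟨w, hw⟩

/-- Tonelli's existence theorem for a causal, locally bounded and continuous operator. -/
theorem exists_causal_integral_solution (Φ : (ℝ → ℝ) → ℝ → ℝ) (a : ℝ) (C : ℝ → ℝ)
    (hcont : ∀ x, Continuous x → Continuous (Φ x))
    (hcausal : ∀ x y r, 0 ≤ r → (∀ s ∈ Icc 0 r, x s = y s) → Φ x r = Φ y r)
    (hbound : ∀ R x s, Continuous x → 0 ≤ s → s ≤ R → |Φ x s| ≤ C R)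
    (hlim : ∀ (x : ℕ → ℝ → ℝ) (y : ℝ → ℝ), (∀ n, Continuous (x n)) → Continuous y →
      (∀ r, Tendsto (fun n => x n r) atTop (𝓝 (y r))) →
      ∀ s, 0 ≤ s → Tendsto (fun n => Φ (x n) s) atTop (𝓝 (Φ y s))) :
    ∃ w : ℝ → ℝ, Continuous w ∧ ∀ r, 0 ≤ r → w r = a + ∫ s in (0 : ℝ)..r, Φ w s := by
  let T : ℕ → (ℝ → ℝ) → ℝ → ℝ := fun n x r =>
    a + ∫ s in (0 : ℝ)..max (r - 1 / ((n : ℝ) + 1)) 0, Φ x s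
  have hTcont : ∀ n x, Continuous x → Continuous (T n x) := by
    intro n x hx
    have h1 : Continuous fun u : ℝ => ∫ s in (0 : ℝ)..u, Φ x s :=
      intervalIntegral.continuous_primitive (fun _ _ => (hcont x hx).intervalIntegrable _ _) 0
    exact continuous_const.add (h1.comp (by fun_prop))
  have hTiter : ∀ n k, Continuous ((T n)^[k] fun _ => a) := by
    intro n k
    induction k with
    | zero => exact continuous_const
    | succ k ih => rw [Function.iterate_succ_apply']; exact hTcont n _ ih
  have hstab : ∀ (n k : ℕ) (r : ℝ), r ≤ (k : ℝ) * (1 / ((n : ℝ) + 1)) →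
      T n ((T n)^[k] fun _ => a) r = ((T n)^[k] fun _ => a) r := by
    intro n k
    have hpos : (0 : ℝ) < 1 / ((n : ℝ) + 1) := by positivity
    induction k with
    | zero =>
      intro r hr
      have : max (r - 1 / ((n : ℝ) + 1)) 0 = 0 := max_eq_right (by
        simp only [Nat.cast_zero, zero_mul] at hr; linarith)
      simp only [T, this]
      simp
    | succ k ih =>
      intro r hr
      rw [Function.iterate_succ_apply']
      simp only [T]
      congr 1
      refine intervalIntegral.integral_congr fun s hs => ?_
      rw [uIcc_of_le (le_max_right _ _)] at hs
      refine hcausal _ _ s hs.1 fun u hu => ih u ?_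
      have h1 := hu.2.trans hs.2
      push_cast at hr
      rcases le_max_iff.1 h1 with h | h
      · linarith
      · exact h.trans (by positivity)
  have hTlip : ∀ R n x r s, Continuous x → r ≤ R → s ≤ R →
      |T n x r - T n x s| ≤ C (max R 0) * |r - s| := by
    intro R n x r s hx hr hs
    have hpos : (0 : ℝ) < 1 / ((n : ℝ) + 1) := by positivity
    have hC0 : 0 ≤ C (max R 0) :=
      (abs_nonneg _).trans (hbound (max R 0) x 0 hx le_rfl (le_max_right _ _))
    have h1 : T n x r - T n x s = ∫ u in max (s - 1 / ((n : ℝ) + 1)) 0..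
        max (r - 1 / ((n : ℝ) + 1)) 0, Φ x u := by
      simp only [T]
      rw [add_sub_add_left_eq_sub]
      exact intervalIntegral.integral_interval_sub_left ((hcont x hx).intervalIntegrable _ _)
        ((hcont x hx).intervalIntegrable _ _)
    rw [h1, ← Real.norm_eq_abs]
    refine (intervalIntegral.norm_integral_le_of_norm_le_const (C := C (max R 0)) ?_).trans ?_
    · intro u hu
      rw [Real.norm_eq_abs]
      refine hbound _ x u hx ?_ ?_
      · exact (le_min (le_max_right _ _) (le_max_right _ _)).trans hu.1.le
      · exact hu.2.trans (max_le (max_le_max (by linarith) le_rfl)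
          (max_le_max (by linarith) le_rfl))
    · refine mul_le_mul_of_nonneg_left ((abs_max_sub_max_le_abs _ _ _).trans (le_of_eq ?_)) hC0
      congr 1; ring
  let y : ℕ → ℝ → ℝ := fun n => T n ((T n)^[(n + 1) * (n + 1)] fun _ => a)
  have hycont : ∀ n, Continuous (y n) := fun n => hTcont n _ (hTiter n _)
  have hyfix : ∀ (n : ℕ) (r : ℝ), r ≤ (n : ℝ) → y n r = T n (y n) r := by
    intro n r hr
    have hn : (((n + 1) * (n + 1) : ℕ) : ℝ) * (1 / ((n : ℝ) + 1)) = n + 1 := by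
      push_cast; field_simp
    have h := hstab n ((n + 1) * (n + 1) + 1) r (by
      push_cast at hn ⊢
      have hpos : (0 : ℝ) < 1 / ((n : ℝ) + 1) := by positivity
      rw [add_mul, hn]; linarith)
    rw [Function.iterate_succ_apply'] at h
    exact h.symm
  have hy0 : ∀ n, y n 0 = a := by
    intro n
    have : max (0 - 1 / ((n : ℝ) + 1)) 0 = 0 := max_eq_right (by
      have hpos : (0 : ℝ) < 1 / ((n : ℝ) + 1) := by positivity
      linarith)
    simp only [y, T, this]
    simp
  have hylip : ∀ R n r s, r ≤ R → s ≤ R → |y n r - y n s| ≤ C (max R 0) * |r - s| :=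
    fun R n r s hr hs => hTlip R n _ r s (hTiter n _) hr hs
  obtain ⟨φ, hφ, w, hw⟩ := exists_pointwise_convergent_subseq y a (fun R => C (max R 0)) hy0 hylip
  have hwcont : Continuous w := by
    rw [continuous_iff_continuousAt]
    intro r
    have hL : LipschitzOnWith (C (max (r + 1) 0)).toNNReal w (Iic (r + 1)) := by
      refine LipschitzOnWith.of_dist_le_mul fun u hu v hv => ?_
      rw [Real.dist_eq, Real.dist_eq]
      refine le_trans (le_of_tendsto ((hw u).sub (hw v)).abs
        (Eventually.of_forall fun n => hylip (r + 1) (φ n) u v hu hv)) ?_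
      gcongr
      exact Real.le_coe_toNNReal _
    exact hL.continuousOn.continuousAt (Iic_mem_nhds (by linarith))
  refine ⟨w, hwcont, fun r hr => ?_⟩
  have hI : Tendsto (fun n => ∫ s in (0 : ℝ)..r, Φ (y (φ n)) s) atTop
      (𝓝 (∫ s in (0 : ℝ)..r, Φ w s)) := by
    refine intervalIntegral.tendsto_integral_filter_of_dominated_convergence (fun _ => C r) ?_ ?_
      intervalIntegrable_const ?_
    · exact Eventually.of_forall fun n => (hcont _ (hycont _)).aestronglyMeasurable
    · refine Eventually.of_forall fun n => Eventually.of_forall fun s hs => ?_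
      rw [uIoc_of_le hr] at hs
      exact hbound r _ s (hycont _) hs.1.le hs.2
    · refine Eventually.of_forall fun s hs => ?_
      rw [uIoc_of_le hr] at hs
      exact hlim _ w (fun n => hycont _) hwcont hw s hs.1.le
  have hδ : Tendsto (fun n => C r * (1 / ((φ n : ℝ) + 1))) atTop (𝓝 0) := by
    simpa using (tendsto_one_div_add_atTop_nhds_zero_nat (𝕜 := ℝ).comp
      hφ.tendsto_atTop).const_mul (C r)
  have hdiff : Tendsto (fun n => y (φ n) r - (a + ∫ s in (0 : ℝ)..r, Φ (y (φ n)) s)) atTop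
      (𝓝 0) := by
    refine squeeze_zero_norm' ?_ hδ
    obtain ⟨n₀, hn₀⟩ := exists_nat_ge r
    filter_upwards [eventually_ge_atTop n₀] with n hn
    have hrn : r ≤ (φ n : ℝ) := hn₀.trans (by exact_mod_cast hn.trans (hφ.id_le n))
    have hpos : (0 : ℝ) < 1 / ((φ n : ℝ) + 1) := by positivity
    have hmax : max (r - 1 / ((φ n : ℝ) + 1)) 0 ≤ r := max_le (by linarith) hr
    rw [hyfix _ r hrn]
    simp only [T]
    rw [add_sub_add_left_eq_sub, intervalIntegral.integral_interval_sub_left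
      ((hcont _ (hycont _)).intervalIntegrable _ _) ((hcont _ (hycont _)).intervalIntegrable _ _)]
    have hC0 : 0 ≤ C r := (abs_nonneg _).trans (hbound r _ 0 (hycont (φ n)) le_rfl hr)
    refine (intervalIntegral.norm_integral_le_of_norm_le_const (C := C r) ?_).trans ?_
    · intro u hu
      rw [uIoc_of_ge hmax] at hu
      exact hbound r _ u (hycont _) ((le_max_right _ _).trans hu.1.le) hu.2
    · gcongr
      rw [abs_sub_comm, abs_of_nonneg (by linarith)]
      linarith [le_max_left (r - 1 / ((φ n : ℝ) + 1)) 0]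
  have h1 := (hw r).sub (hI.const_add a)
  have := tendsto_nhds_unique h1 hdiff
  linarith

theorem abs_phiP {s : ℝ} (hs : 1 < s) (x : ℝ) : |phiP s x| = |x| ^ (s - 1) := by
  rcases eq_or_ne x 0 with rfl | hx
  · simp [phiP, Real.zero_rpow (show s - 1 ≠ 0 by linarith)]
  · have h : 0 < |x| := abs_pos.2 hx
    rw [phiP, abs_mul, abs_of_nonneg (by positivity : 0 ≤ |x| ^ (s - 2)), ← Real.rpow_add_one h.ne']
    congr 1; ring

theorem phiP_neg (s x : ℝ) : phiP s (-x) = -phiP s x := by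
  simp [phiP]

theorem phiP_zero (s : ℝ) : phiP s 0 = 0 := by
  simp [phiP]

theorem phiP_of_nonneg {s : ℝ} (hs : 1 < s) {x : ℝ} (hx : 0 ≤ x) : phiP s x = x ^ (s - 1) := by
  have h := abs_phiP hs x
  rwa [abs_of_nonneg hx, abs_of_nonneg (by unfold phiP; positivity)] at h

theorem mul_phiP_nonneg (s x : ℝ) : 0 ≤ phiP s x * x := by
  rw [phiP, mul_assoc]
  exact mul_nonneg (by positivity) (mul_self_nonneg x)

theorem phiP_eq_max {s : ℝ} (hs : 1 < s) (x : ℝ) :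
    phiP s x = (max x 0) ^ (s - 1) - (max (-x) 0) ^ (s - 1) := by
  have hs' : s - 1 ≠ 0 := by linarith
  rcases le_total 0 x with hx | hx
  · rw [max_eq_left hx, max_eq_right (by linarith), Real.zero_rpow hs', phiP_of_nonneg hs hx,
      sub_zero]
  · rw [max_eq_right hx, max_eq_left (by linarith), Real.zero_rpow hs', zero_sub,
      ← phiP_of_nonneg hs (by linarith : 0 ≤ -x), phiP_neg, neg_neg]

theorem continuous_phiP {s : ℝ} (hs : 1 < s) : Continuous (phiP s) := by
  have h : phiP s = fun x => (max x 0) ^ (s - 1) - (max (-x) 0) ^ (s - 1) :=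
    funext (phiP_eq_max hs)
  rw [h]
  have hc := Real.continuous_rpow_const (show 0 ≤ s - 1 by linarith)
  exact (hc.comp (by fun_prop)).sub (hc.comp (by fun_prop))

theorem monotone_phiP {s : ℝ} (hs : 1 < s) : Monotone (phiP s) := by
  intro x y hxy
  rw [phiP_eq_max hs, phiP_eq_max hs]
  have hs' : 0 ≤ s - 1 := by linarith
  gcongr

theorem phiP_phiP {p s : ℝ} (hs : 1 < s) (h : (p - 1) * (s - 1) = 1) (x : ℝ) :
    phiP p (phiP s x) = x := by
  rcases eq_or_ne x 0 with rfl | hx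
  · simp [phiP_zero]
  · have hx' : 0 < |x| := abs_pos.2 hx
    conv_lhs => rw [phiP, abs_phiP hs, phiP]
    rw [← Real.rpow_mul hx'.le, ← mul_assoc, ← Real.rpow_add hx',
      show (s - 1) * (p - 2) + (s - 2) = 0 by linarith, Real.rpow_zero, one_mul]

theorem hasDerivAt_abs_rpow_div {s : ℝ} (hs : 1 < s) (x : ℝ) :
    HasDerivAt (fun x : ℝ => |x| ^ s / s) (phiP s x) x := by
  have : s ≠ 0 := by linarith
  have h : phiP s x = s * |x| ^ (s - 2) * x / s := by
    simp only [phiP]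
    field_simp
  rw [h]
  exact (hasDerivAt_abs_rpow x hs).div_const s

theorem abs_rpow_sub_rpow_le {t l B x y : ℝ} (ht : 0 < t) (hl : 0 < l) (hx : l ≤ x) (hxB : x ≤ B)
    (hy : l ≤ y) (hyB : y ≤ B) : |x ^ t - y ^ t| ≤ t * B ^ t / l * |x - y| := by
  refine (convex_Icc l B).norm_image_sub_le_of_norm_hasDerivWithin_le (f := fun z : ℝ => z ^ t)
    (f' := fun z => t * z ^ (t - 1)) (x := y) (y := x) (fun z hz => ?_) (fun z hz => ?_)
    ⟨hy, hyB⟩ ⟨hx, hxB⟩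
  · exact (Real.hasDerivAt_rpow_const (Or.inl (hl.trans_le hz.1).ne')).hasDerivWithinAt
  · have hz0 : 0 < z := hl.trans_le hz.1
    rw [Real.norm_eq_abs, abs_of_nonneg (by positivity), Real.rpow_sub_one hz0.ne', ← mul_div_assoc]
    have hB : 0 < B := hz0.trans_le hz.2
    gcongr
    · exact hz.2
    · exact hz.1

/-- Quantitative Lipschitz bound for `phiP s` on one side of the origin. -/
theorem abs_phiP_sub_le {s l B x y σ : ℝ} (hs : 1 < s) (hl : 0 < l) (hσ : σ = 1 ∨ σ = -1)
    (hx : l ≤ σ * x) (hxB : |x| ≤ B) (hy : l ≤ σ * y) (hyB : |y| ≤ B) :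
    |phiP s x - phiP s y| ≤ (s - 1) * B ^ (s - 1) / l * |x - y| := by
  wlog h : σ = 1 generalizing x y σ
  · have h' : σ = -1 := hσ.resolve_left h
    have := this (x := -x) (y := -y) (σ := 1) (Or.inl rfl) (by rw [h'] at hx; linarith)
      (by rwa [abs_neg]) (by rw [h'] at hy; linarith) (by rwa [abs_neg]) rfl
    rwa [phiP_neg, phiP_neg, neg_sub_neg, neg_sub_neg, abs_sub_comm, abs_sub_comm y] at this
  · subst h
    rw [one_mul] at hx hy
    rw [phiP_of_nonneg hs (hl.le.trans hx), phiP_of_nonneg hs (hl.le.trans hy)]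
    exact abs_rpow_sub_rpow_le (by linarith) hl hx ((le_abs_self x).trans hxB) hy
      ((le_abs_self y).trans hyB)

theorem exists_phiP_lipschitz {s : ℝ} (hs : 2 < s) (M : ℝ) :
    ∃ L, 0 ≤ L ∧ ∀ x y, |x| ≤ M → |y| ≤ M → |phiP s x - phiP s y| ≤ L * |x - y| := by
  rcases lt_or_ge M 0 with hM | hM
  · exact ⟨0, le_rfl, fun x y hx _ => absurd ((abs_nonneg x).trans hx) (not_le.2 hM)⟩
  have key : ∀ x ∈ Icc 0 M, ∀ y ∈ Icc 0 M,
      |x ^ (s - 1) - y ^ (s - 1)| ≤ (s - 1) * M ^ (s - 2) * |x - y| := by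
    intro x hx y hy
    refine (convex_Icc 0 M).norm_image_sub_le_of_norm_hasDerivWithin_le
      (f := fun z : ℝ => z ^ (s - 1)) (f' := fun z => (s - 1) * z ^ (s - 1 - 1)) (x := y) (y := x)
      (fun z hz => ?_) (fun z hz => ?_) hy hx
    · exact (Real.hasDerivAt_rpow_const (Or.inr (by linarith))).hasDerivWithinAt
    · have hz0 : 0 ≤ z := hz.1
      have : 0 < s - 1 := by linarith
      rw [Real.norm_eq_abs, abs_of_nonneg (by positivity), show s - 1 - 1 = s - 2 by ring]
      have : 0 ≤ s - 2 := by linarith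
      gcongr
      exact hz.2
  have hs1 : 0 ≤ s - 1 := by linarith
  refine ⟨2 * ((s - 1) * M ^ (s - 2)), by positivity, fun x y hx hy => ?_⟩
  have hx' := abs_le.1 hx
  have hy' := abs_le.1 hy
  have h1 := key (max x 0) ⟨le_max_right _ _, max_le hx'.2 hM⟩ (max y 0)
    ⟨le_max_right _ _, max_le hy'.2 hM⟩
  have h2 := key (max (-x) 0) ⟨le_max_right _ _, max_le (by linarith) hM⟩ (max (-y) 0)
    ⟨le_max_right _ _, max_le (by linarith) hM⟩
  have h3 : |max x 0 - max y 0| ≤ |x - y| := abs_max_sub_max_le_abs _ _ _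
  have h4 : |max (-x) 0 - max (-y) 0| ≤ |x - y| := by
    refine (abs_max_sub_max_le_abs _ _ _).trans ?_
    rw [neg_sub_neg, abs_sub_comm]
  have hK : 0 ≤ (s - 1) * M ^ (s - 2) := by positivity
  have h5 := h1.trans (mul_le_mul_of_nonneg_left h3 hK)
  have h6 := h2.trans (mul_le_mul_of_nonneg_left h4 hK)
  rw [phiP_eq_max (by linarith), phiP_eq_max (by linarith)]
  rw [abs_le] at h5 h6 ⊢
  constructor <;> linarith [h5.1, h5.2, h6.1, h6.2]

/-- The zeroth-order term `α x + |x|^{q-1} x` of equation (E). -/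
noncomputable def reaction (q α x : ℝ) : ℝ := α * x + phiP (q + 1) x

theorem phiP_add_one (q x : ℝ) : phiP (q + 1) x = |x| ^ (q - 1) * x := by
  rw [phiP]; congr 2; ring

theorem continuous_reaction {q : ℝ} (hq : 1 < q) (α : ℝ) : Continuous (reaction q α) :=
  (continuous_const.mul continuous_id).add (continuous_phiP (by linarith))

theorem reaction_ne_zero {q α x : ℝ} (hα : 0 < α) (hx : x ≠ 0) : reaction q α x ≠ 0 := by
  rw [reaction, phiP_add_one, ← add_mul]
  exact mul_ne_zero (by positivity) hx

theorem exists_reaction_lipschitz {q : ℝ} (hq : 1 < q) (α M : ℝ) :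
    ∃ L, 0 ≤ L ∧ ∀ x y, |x| ≤ M → |y| ≤ M →
      |reaction q α x - reaction q α y| ≤ L * |x - y| := by
  obtain ⟨L, hL, h⟩ := exists_phiP_lipschitz (s := q + 1) (by linarith) M
  refine ⟨|α| + L, by positivity, fun x y hx hy => ?_⟩
  have : reaction q α x - reaction q α y
      = α * (x - y) + (phiP (q + 1) x - phiP (q + 1) y) := by
    rw [reaction, reaction]; ring
  rw [this, add_mul, ← abs_mul]
  exact (abs_add_le _ _).trans (by gcongr; exact h x y hx hy)

/-- The energy of (E) in terms of `w` and `v = |w'|^{p-2} w'`; here `s = p / (p - 1)`. -/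
noncomputable def energy (s q α w v : ℝ) : ℝ :=
  |v| ^ s / s + (α / 2 * w ^ 2 + |w| ^ (q + 1) / (q + 1))

theorem energy_antitoneOn {n s q α x y : ℝ} {w v : ℝ → ℝ} (hn : 1 ≤ n) (hs : 1 < s) (hq : 1 < q)
    (hx : 0 ≤ x) (hw : ContinuousOn w (Icc x y)) (hv : ContinuousOn v (Icc x y))
    (hw' : ∀ r ∈ Ioo x y, HasDerivAt w (phiP s (v r)) r)
    (hv' : ∀ r ∈ Ioo x y,
      HasDerivAt v (-((n - 1) / r * v r) - r * phiP s (v r) - reaction q α (w r)) r) :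
    AntitoneOn (fun r => energy s q α (w r) (v r)) (Icc x y) := by
  have hs0 : 0 ≤ s := by linarith
  have hq0 : 0 ≤ q + 1 := by linarith
  have hE : ∀ r ∈ Ioo x y, HasDerivAt (fun r => energy s q α (w r) (v r))
      (-((n - 1) / r * (phiP s (v r) * v r)) - r * (phiP s (v r) * phiP s (v r))) r := by
    intro r hr
    have h1 := (hasDerivAt_abs_rpow_div hs (v r)).comp r (hv' r hr)
    have h2 := (hasDerivAt_abs_rpow_div (show 1 < q + 1 by linarith) (w r)).comp r (hw' r hr)
    have h3 := ((hw' r hr).pow 2).const_mul (α / 2)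
    refine (h1.add (h3.add h2)).congr_deriv ?_
    simp only [reaction]
    push_cast
    ring
  refine antitoneOn_of_deriv_nonpos (convex_Icc x y) ?_ ?_ ?_
  · have h1 : ContinuousOn (fun r => |v r| ^ s) (Icc x y) :=
      hv.abs.rpow_const fun _ _ => Or.inr hs0
    have h2 : ContinuousOn (fun r => |w r| ^ (q + 1)) (Icc x y) :=
      hw.abs.rpow_const fun _ _ => Or.inr hq0
    exact (h1.div_const _).add ((continuousOn_const.mul (hw.pow 2)).add (h2.div_const _))
  · rw [interior_Icc]
    exact fun r hr => (hE r hr).differentiableAt.differentiableWithinAt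
  · rw [interior_Icc]
    intro r hr
    rw [(hE r hr).deriv]
    have hr0 : 0 < r := hx.trans_lt hr.1
    have h1 := mul_phiP_nonneg s (v r)
    have h2 := mul_self_nonneg (phiP s (v r))
    have h3 : 0 ≤ (n - 1) / r := div_nonneg (by linarith) hr0.le
    linarith [mul_nonneg h3 h1, mul_nonneg hr0.le h2]

theorem abs_le_of_energy_le {s q α w v a : ℝ} (hs : 1 < s) (hq : 1 < q) (hα : 0 < α)
    (h : energy s q α w v ≤ energy s q α a 0) : |w| ≤ |a| := by
  by_contra! hlt
  have h1 : |a| ^ (q + 1) / (q + 1) ≤ |w| ^ (q + 1) / (q + 1) := by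
    have : 0 < q + 1 := by linarith
    gcongr
  have h2 : α / 2 * a ^ 2 < α / 2 * w ^ 2 := by
    have := sq_lt_sq.2 hlt
    gcongr
  have h3 : 0 ≤ |v| ^ s / s := by positivity
  have h4 : |(0 : ℝ)| ^ s / s = 0 := by
    rw [abs_zero, Real.zero_rpow (by linarith), zero_div]
  rw [energy, energy, h4] at h
  linarith

theorem eq_zero_of_energy_le {s q α w v : ℝ} (hs : 1 < s) (hq : 1 < q) (hα : 0 < α)
    (h : energy s q α w v ≤ energy s q α 0 0) : w = 0 ∧ v = 0 := by
  have hw : w = 0 := by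
    have := abs_le_of_energy_le hs hq hα h
    rwa [abs_zero, abs_nonpos_iff] at this
  refine ⟨hw, ?_⟩
  subst hw
  by_contra hv
  have hv' : 0 < |v| ^ s / s := by
    have := abs_pos.2 hv
    positivity
  have h4 : |(0 : ℝ)| ^ s / s = 0 := by
    rw [abs_zero, Real.zero_rpow (by linarith), zero_div]
  rw [energy, energy, h4] at h
  linarith

/-- The right-hand side of the equation for `v = |w'|^{p-2} w'`, extended to `r = 0` by its limit
along solutions with `w(0) = a`, `w'(0) = 0`. -/
noncomputable def profileRate (n s q α a r w v : ℝ) : ℝ :=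
  if r = 0 then -(reaction q α a / n) else -((n - 1) / r * v) - r * phiP s v - reaction q α w

/-- The first-order system solved by a solution `w` of (E) with `w(0) = a`, `w'(0) = 0` and
`v = |w'|^{p-2} w'`; here `s = p / (p - 1)` and `n` is the dimension. -/
structure IsProfile (n s q α a : ℝ) (w v : ℝ → ℝ) : Prop where
  continuousOn_fst : ContinuousOn w (Ici 0)
  continuousOn_snd : ContinuousOn v (Ici 0)
  fst_zero : w 0 = a
  snd_zero : v 0 = 0
  hasDerivAt_fst : ∀ r, 0 < r → HasDerivAt w (phiP s (v r)) r
  hasDerivAt_snd : ∀ r, 0 < r →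
    HasDerivAt v (-((n - 1) / r * v r) - r * phiP s (v r) - reaction q α (w r)) r
  hasDerivWithinAt_snd_zero : HasDerivWithinAt v (-(reaction q α a / n)) (Ici 0) 0

namespace IsProfile

variable {n s q α a x y : ℝ} {w v w₁ v₁ w₂ v₂ : ℝ → ℝ}

theorem hasDerivWithinAt_fst (h : IsProfile n s q α a w v) (hs : 1 < s) {r : ℝ} (hr : 0 ≤ r) :
    HasDerivWithinAt w (phiP s (v r)) (Ici r) r := by
  rcases hr.eq_or_lt with rfl | hr
  · refine hasDerivWithinAt_Ici_of_tendsto_deriv (s := Ioi 0)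
      (fun t ht => (h.hasDerivAt_fst t ht).differentiableAt.differentiableWithinAt)
      ((h.continuousOn_fst 0 self_mem_Ici).mono Ioi_subset_Ici_self) self_mem_nhdsWithin ?_
    have h1 : Tendsto (fun t => phiP s (v t)) (𝓝[>] 0) (𝓝 (phiP s (v 0))) :=
      ((continuous_phiP hs).tendsto _).comp
        ((h.continuousOn_snd 0 self_mem_Ici).mono Ioi_subset_Ici_self)
    refine h1.congr' ?_
    filter_upwards [self_mem_nhdsWithin] with t ht
    exact (h.hasDerivAt_fst t ht).deriv.symm
  · exact (h.hasDerivAt_fst r hr).hasDerivWithinAt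

theorem hasDerivWithinAt_snd (h : IsProfile n s q α a w v) {r : ℝ} (hr : 0 ≤ r) :
    HasDerivWithinAt v (profileRate n s q α a r (w r) (v r)) (Ici r) r := by
  rcases hr.eq_or_lt with rfl | hr
  · simpa [profileRate] using h.hasDerivWithinAt_snd_zero
  · simpa [profileRate, hr.ne'] using (h.hasDerivAt_snd r hr).hasDerivWithinAt

theorem snd_sub_le (h₁ : IsProfile n s q α a w₁ v₁) (h₂ : IsProfile n s q α a w₂ v₂) (hn : 1 ≤ n)
    (hs : 1 < s) {κ : ℝ} (hx : 0 ≤ x) (hv : v₁ x = v₂ x) (hκ : 0 ≤ κ)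
    (hreact : ∀ t ∈ Icc x y, |reaction q α (w₁ t) - reaction q α (w₂ t)| ≤ κ) {t : ℝ}
    (ht : t ∈ Icc x y) : v₁ t - v₂ t ≤ κ * (t - x) := by
  have hsub : Icc x y ⊆ Ici 0 := fun u hu => hx.trans hu.1
  have key : ∀ ε > 0, v₁ t - v₂ t ≤ ε + (κ + ε) * (t - x) := by
    intro ε hε
    refine image_le_of_deriv_right_lt_deriv_boundary' (f := fun t => v₁ t - v₂ t)
      (B := fun t => ε + (κ + ε) * (t - x)) (B' := fun _ => κ + ε)
      ((h₁.continuousOn_snd.mono hsub).sub (h₂.continuousOn_snd.mono hsub))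
      (fun u hu => (h₁.hasDerivWithinAt_snd (hx.trans hu.1)).sub
        (h₂.hasDerivWithinAt_snd (hx.trans hu.1))) ?_ (by fun_prop) (fun u hu => ?_) ?_ ht
    · simp [hv, hε.le]
    · simpa using ((((hasDerivAt_id u).sub_const x).const_mul (κ + ε)).const_add ε).hasDerivWithinAt
    · intro u hu heq
      have hpos : 0 < v₁ u - v₂ u := by
        have := mul_nonneg (add_nonneg hκ hε.le) (sub_nonneg.2 hu.1)
        linarith
      have hu0 : 0 < u := by
        rcases (hx.trans hu.1).eq_or_lt with h0 | h0
        · rw [← h0, h₁.snd_zero, h₂.snd_zero] at hpos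
          simp at hpos
        · exact h0
      simp only [profileRate, hu0.ne', if_false]
      have h1 : phiP s (v₂ u) ≤ phiP s (v₁ u) := monotone_phiP hs (by linarith)
      have h2 := (abs_le.1 (hreact u ⟨hu.1, hu.2.le⟩)).1
      have h3 : 0 ≤ (n - 1) / u := div_nonneg (by linarith) hu0.le
      linarith [mul_nonneg h3 hpos.le, mul_nonneg hu0.le (sub_nonneg.2 h1)]
  refine le_of_forall_pos_le_add fun η hη => ?_
  have htx : 0 < 1 + (t - x) := by linarith [ht.1]
  have h1 := key (η / (1 + (t - x))) (by positivity)
  have h2 : η / (1 + (t - x)) * (1 + (t - x)) = η := by field_simp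
  linarith

theorem energy_antitoneOn (h : IsProfile n s q α a w v) (hn : 1 ≤ n) (hs : 1 < s) (hq : 1 < q) :
    AntitoneOn (fun r => energy s q α (w r) (v r)) (Ici 0) := by
  intro x hx y hy hxy
  exact _root_.energy_antitoneOn hn hs hq hx
    (h.continuousOn_fst.mono fun t ht => le_trans hx ht.1)
    (h.continuousOn_snd.mono fun t ht => le_trans hx ht.1)
    (fun r hr => h.hasDerivAt_fst r (lt_of_le_of_lt hx hr.1))
    (fun r hr => h.hasDerivAt_snd r (lt_of_le_of_lt hx hr.1))
    (left_mem_Icc.2 hxy) (right_mem_Icc.2 hxy) hxy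

theorem abs_fst_le (h : IsProfile n s q α a w v) (hn : 1 ≤ n) (hs : 1 < s) (hq : 1 < q)
    (hα : 0 < α) {r : ℝ} (hr : 0 ≤ r) : |w r| ≤ |a| := by
  have := h.energy_antitoneOn hn hs hq self_mem_Ici hr hr
  simp only [h.fst_zero, h.snd_zero] at this
  exact abs_le_of_energy_le hs hq hα this

end IsProfile

theorem exists_one_sided_lower_bound {x b d : ℝ} (h : b ≠ 0 ∨ d ≠ 0) :
    ∃ σ c : ℝ, (σ = 1 ∨ σ = -1) ∧ 0 < c ∧ ∀ v : ℝ → ℝ, v x = b →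
      HasDerivWithinAt v d (Ici x) x → ∀ᶠ t in 𝓝[>] x, c * (t - x) ≤ σ * v t := by
  have hsign : ∀ z : ℝ, ∃ σ : ℝ, (σ = 1 ∨ σ = -1) ∧ σ * z = |z| := by
    intro z
    rcases abs_cases z with hz | hz
    · exact ⟨1, Or.inl rfl, by rw [hz.1, one_mul]⟩
    · exact ⟨-1, Or.inr rfl, by rw [hz.1, neg_one_mul]⟩
  by_cases hb : b = 0
  · have hd : d ≠ 0 := h.resolve_left (not_not.2 hb)
    obtain ⟨σ, hσ, hσd⟩ := hsign d
    have hd' := abs_pos.2 hd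
    refine ⟨σ, |d| / 2, hσ, by positivity, fun v hv hvd => ?_⟩
    have h1 := (hasDerivWithinAt_iff_tendsto_slope' self_notMem_Ioi).1 hvd.Ioi_of_Ici
    have h2 := (h1.const_mul σ).eventually (lt_mem_nhds (show |d| / 2 < σ * d by linarith))
    filter_upwards [h2, self_mem_nhdsWithin] with t ht htx
    have htx' : 0 < t - x := sub_pos.2 htx
    rw [slope_def_field, hv, hb, sub_zero, ← mul_div_assoc, lt_div_iff₀ htx'] at ht
    exact ht.le
  · obtain ⟨σ, hσ, hσb⟩ := hsign b
    have hb' := abs_pos.2 hb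
    refine ⟨σ, |b| / 2, hσ, by positivity, fun v hv hvd => ?_⟩
    have h1 : Tendsto v (𝓝[>] x) (𝓝 b) := by
      rw [← hv]
      exact hvd.continuousWithinAt.mono Ioi_subset_Ici_self
    have h2 := (h1.const_mul σ).eventually (lt_mem_nhds (show |b| / 2 < σ * b by linarith))
    filter_upwards [h2, Ioo_mem_nhdsGT (show x < x + 1 by linarith)] with t ht htx
    nlinarith [htx.1, htx.2]

namespace IsProfile

variable {n s q α a x y : ℝ} {w v w₁ v₁ w₂ v₂ : ℝ → ℝ}

theorem eq_of_lower_bound (h₁ : IsProfile n s q α a w₁ v₁) (h₂ : IsProfile n s q α a w₂ v₂)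
    (hn : 1 ≤ n) (hs : 1 < s) (hq : 1 < q) (hα : 0 < α) (hx : 0 ≤ x) (hw : w₁ x = w₂ x)
    (hv : v₁ x = v₂ x) {σ c : ℝ} (hσ : σ = 1 ∨ σ = -1) (hc : 0 < c)
    (hv₁ : ∀ᶠ t in 𝓝[>] x, c * (t - x) ≤ σ * v₁ t)
    (hv₂ : ∀ᶠ t in 𝓝[>] x, c * (t - x) ≤ σ * v₂ t) :
    ∃ y > x, ∀ t ∈ Icc x y, w₁ t = w₂ t ∧ v₁ t = v₂ t := by
  obtain ⟨L, hL, hlip⟩ := exists_reaction_lipschitz hq α |a|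
  set B := |v₁ x| + 1 with hB
  set K := (s - 1) * B ^ (s - 1) / c * L with hK
  have hs1 : 0 < s - 1 := by linarith
  have hK0 : 0 ≤ K := by positivity
  have hbd : ∀ v : ℝ → ℝ, ContinuousOn v (Ici 0) → v x = v₁ x → ∀ᶠ t in 𝓝[>] x, |v t| < B := by
    intro v hvc hvx
    have h3 : Tendsto (fun t => |v t|) (𝓝[>] x) (𝓝 |v x|) :=
      ((hvc x hx).mono fun t ht => hx.trans (le_of_lt ht)).abs
    exact h3.eventually (gt_mem_nhds (by rw [hvx, hB]; linarith))
  obtain ⟨z, hz, hzsub⟩ := mem_nhdsGT_iff_exists_Ioo_subset.1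
    (((hv₁.and hv₂).and ((hbd v₁ h₁.continuousOn_snd rfl).and
      (hbd v₂ h₂.continuousOn_snd hv.symm))))
  set δ := min ((z - x) / 2) (1 / (2 * (K + 1))) with hδ
  have hzx : 0 < z - x := sub_pos.2 hz
  have hδ0 : 0 < δ := by positivity
  have hδ1 : x + δ < z := by linarith [min_le_left ((z - x) / 2) (1 / (2 * (K + 1)))]
  have hδ2 : K * δ ≤ 1 / 2 := by
    calc K * δ ≤ (K + 1) * (1 / (2 * (K + 1))) := by
          gcongr
          · linarith
          · exact min_le_right _ _
      _ = 1 / 2 := by field_simp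
  have hxδ : x ≤ x + δ := by linarith
  have hsub : Icc x (x + δ) ⊆ Ici 0 := fun t ht => hx.trans ht.1
  have hWc : ContinuousOn (fun t => w₁ t - w₂ t) (Icc x (x + δ)) :=
    (h₁.continuousOn_fst.mono hsub).sub (h₂.continuousOn_fst.mono hsub)
  obtain ⟨r, hr, hmax⟩ := isCompact_Icc.exists_isMaxOn (nonempty_Icc.2 hxδ) hWc.abs
  set m := |w₁ r - w₂ r| with hm
  have hm0 : 0 ≤ m := abs_nonneg _
  have hWm : ∀ t ∈ Icc x (x + δ), |w₁ t - w₂ t| ≤ m := fun t ht => hmax ht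
  have hreact : ∀ t ∈ Icc x (x + δ),
      |reaction q α (w₁ t) - reaction q α (w₂ t)| ≤ L * m := fun t ht =>
    (hlip _ _ (h₁.abs_fst_le hn hs hq hα (hsub ht)) (h₂.abs_fst_le hn hs hq hα (hsub ht))).trans
      (mul_le_mul_of_nonneg_left (hWm t ht) hL)
  have hV : ∀ t ∈ Icc x (x + δ), |v₁ t - v₂ t| ≤ L * m * (t - x) := by
    intro t ht
    have h3 := h₁.snd_sub_le h₂ hn hs hx hv (by positivity) hreact ht
    have h4 := h₂.snd_sub_le h₁ hn hs (κ := L * m) hx hv.symm (by positivity)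
      (fun t ht => by rw [abs_sub_comm]; exact hreact t ht) ht
    exact abs_le.2 ⟨by linarith, h3⟩
  have hW : ∀ t ∈ Icc x (x + δ), |w₁ t - w₂ t| ≤ K * m * (t - x) := by
    intro t ht
    have h3 := norm_image_sub_le_of_norm_deriv_right_le_segment (C := K * m) hWc
      (fun u hu => (h₁.hasDerivWithinAt_fst hs (hx.trans hu.1)).sub
        (h₂.hasDerivWithinAt_fst hs (hx.trans hu.1))) ?_ t ht
    · simpa [hw] using h3
    · intro u hu
      rw [Real.norm_eq_abs]
      rcases hu.1.eq_or_lt with rfl | hxu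
      · rw [hv, sub_self, abs_zero]; positivity
      · obtain ⟨⟨e1, e2⟩, e3, e4⟩ := hzsub ⟨hxu, hu.2.trans hδ1⟩
        have hxu' : 0 < u - x := sub_pos.2 hxu
        refine (abs_phiP_sub_le hs (by positivity) hσ e1 e3.le e2 e4.le).trans ?_
        calc (s - 1) * B ^ (s - 1) / (c * (u - x)) * |v₁ u - v₂ u|
            ≤ (s - 1) * B ^ (s - 1) / (c * (u - x)) * (L * m * (u - x)) := by
              gcongr
              exact hV u ⟨hu.1, hu.2.le⟩
          _ = K * m := by
              rw [hK]; field_simp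
  have hm_zero : m = 0 := by
    have h3 := hW r hr
    have h4 : K * m * (r - x) ≤ K * m * δ := by
      gcongr
      linarith [hr.2]
    nlinarith
  refine ⟨x + δ, by linarith, fun t ht => ⟨?_, ?_⟩⟩
  · have h3 := hWm t ht
    rw [hm_zero, abs_nonpos_iff] at h3
    linarith
  · have h3 := hV t ht
    rw [hm_zero, mul_zero, zero_mul, abs_nonpos_iff] at h3
    linarith

theorem eventually_eq (h₁ : IsProfile n s q α a w₁ v₁) (h₂ : IsProfile n s q α a w₂ v₂)
    (hn : 1 ≤ n) (hs : 1 < s) (hq : 1 < q) (hα : 0 < α) (ha : a ≠ 0) (hx : 0 ≤ x)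
    (hw : w₁ x = w₂ x) (hv : v₁ x = v₂ x) :
    ∃ y > x, ∀ t ∈ Icc x y, w₁ t = w₂ t ∧ v₁ t = v₂ t := by
  by_cases hzero : w₁ x = 0 ∧ v₁ x = 0
  · have hvanish : ∀ {w v : ℝ → ℝ}, IsProfile n s q α a w v → w x = 0 → v x = 0 →
        ∀ t, x ≤ t → w t = 0 ∧ v t = 0 := by
      intro w v h hwx hvx t ht
      have h3 := h.energy_antitoneOn hn hs hq hx (hx.trans ht) ht
      simp only [hwx, hvx] at h3
      exact eq_zero_of_energy_le hs hq hα h3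
    refine ⟨x + 1, by linarith, fun t ht => ?_⟩
    obtain ⟨e1, e2⟩ := hvanish h₁ hzero.1 hzero.2 t ht.1
    obtain ⟨e3, e4⟩ := hvanish h₂ (hw ▸ hzero.1) (hv ▸ hzero.2) t ht.1
    exact ⟨e1.trans e3.symm, e2.trans e4.symm⟩
  · have hnd : v₁ x ≠ 0 ∨ profileRate n s q α a x (w₁ x) (v₁ x) ≠ 0 := by
      by_contra! hcon
      obtain ⟨hv0, hd0⟩ := hcon
      have hw0 : w₁ x ≠ 0 := fun hw0 => hzero ⟨hw0, hv0⟩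
      rw [profileRate] at hd0
      split_ifs at hd0 with hx0
      · have := reaction_ne_zero (q := q) hα ha
        rw [neg_eq_zero, div_eq_zero_iff] at hd0
        rcases hd0 with h3 | h3
        · exact this h3
        · linarith
      · rw [hv0, phiP_zero] at hd0
        exact reaction_ne_zero (q := q) hα hw0 (by linarith)
    obtain ⟨σ, c, hσ, hc, hlow⟩ := exists_one_sided_lower_bound (x := x) hnd
    refine h₁.eq_of_lower_bound h₂ hn hs hq hα hx hw hv hσ hc
      (hlow v₁ rfl (h₁.hasDerivWithinAt_snd hx)) (hlow v₂ hv.symm ?_)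
    rw [hw, hv]
    exact h₂.hasDerivWithinAt_snd hx

theorem eq (h₁ : IsProfile n s q α a w₁ v₁) (h₂ : IsProfile n s q α a w₂ v₂)
    (hn : 1 ≤ n) (hs : 1 < s) (hq : 1 < q) (hα : 0 < α) (ha : a ≠ 0) {r : ℝ} (hr : 0 ≤ r) :
    w₁ r = w₂ r := by
  have hsub : Icc 0 r ⊆ Ici 0 := fun t ht => ht.1
  have hclosed : IsClosed ({t | w₁ t = w₂ t ∧ v₁ t = v₂ t} ∩ Icc 0 r) := by
    have hc : ContinuousOn (fun t => (w₁ t - w₂ t, v₁ t - v₂ t)) (Icc 0 r) :=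
      ((h₁.continuousOn_fst.mono hsub).sub (h₂.continuousOn_fst.mono hsub)).prodMk
        ((h₁.continuousOn_snd.mono hsub).sub (h₂.continuousOn_snd.mono hsub))
    convert hc.preimage_isClosed_of_isClosed isClosed_Icc
      (isClosed_singleton (x := ((0 : ℝ), (0 : ℝ)))) using 1
    ext t
    simp [sub_eq_zero, and_comm]
  refine (hclosed.Icc_subset_of_forall_exists_gt ?_ ?_ (right_mem_Icc.2 hr)).1
  · simp [h₁.fst_zero, h₂.fst_zero, h₁.snd_zero, h₂.snd_zero]
  · rintro x ⟨⟨hw, hv⟩, hx⟩ y hy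
    obtain ⟨z, hz, heq⟩ := h₁.eventually_eq h₂ hn hs hq hα ha hx.1 hw hv
    have hxm : x < min y z := lt_min hy hz
    exact ⟨min y z, heq _ ⟨hxm.le, min_le_right _ _⟩, hxm, min_le_left _ _⟩

end IsProfile

namespace IsProfile

variable {n s q α a : ℝ} {w v : ℝ → ℝ}

theorem tendsto_snd_div (h : IsProfile n s q α a w v) :
    Tendsto (fun r => v r / r) (𝓝[>] 0) (𝓝 (-(reaction q α a / n))) := by
  have h1 := (hasDerivWithinAt_iff_tendsto_slope' self_notMem_Ioi).1
    h.hasDerivWithinAt_snd_zero.Ioi_of_Ici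
  refine h1.congr fun r => ?_
  rw [slope_def_field, h.snd_zero, sub_zero, sub_zero]

theorem continuousOn_profileRate (h : IsProfile n s q α a w v) (hn : 1 ≤ n) (hs : 1 < s)
    (hq : 1 < q) : ContinuousOn (fun r => profileRate n s q α a r (w r) (v r)) (Ici 0) := by
  have hv : ContinuousOn (fun r => phiP s (v r)) (Ici 0) :=
    (continuous_phiP hs).comp_continuousOn h.continuousOn_snd
  have hw : ContinuousOn (fun r => reaction q α (w r)) (Ici 0) :=
    (continuous_reaction hq α).comp_continuousOn h.continuousOn_fst
  intro r hr
  rcases (mem_Ici.1 hr).eq_or_lt with rfl | hr0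
  · rw [← continuousWithinAt_Ioi_iff_Ici]
    have h1 : Tendsto (fun r => -((n - 1) * (v r / r)) - r * phiP s (v r) - reaction q α (w r))
        (𝓝[>] 0) (𝓝 (-((n - 1) * -(reaction q α a / n)) - 0 * phiP s (v 0)
          - reaction q α (w 0))) :=
      ((h.tendsto_snd_div.const_mul _).neg.sub
        ((tendsto_id.mono_left nhdsWithin_le_nhds).mul
          ((hv 0 hr).mono Ioi_subset_Ici_self))).sub ((hw 0 hr).mono Ioi_subset_Ici_self)
    have h2 : -((n - 1) * -(reaction q α a / n)) - 0 * phiP s (v 0) - reaction q α (w 0)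
        = profileRate n s q α a 0 (w 0) (v 0) := by
      rw [profileRate, if_pos rfl, h.fst_zero]
      field_simp
      ring
    rw [h2] at h1
    refine h1.congr' ?_
    filter_upwards [self_mem_nhdsWithin] with t ht
    rw [profileRate, if_neg (ne_of_gt ht)]
    ring
  · have h1 : ContinuousOn (fun r => -((n - 1) / r * v r) - r * phiP s (v r) - reaction q α (w r))
        (Ioi 0) := by
      have hsub := Ioi_subset_Ici_self (a := (0 : ℝ))
      exact ((((continuousOn_const.div continuousOn_id fun t ht => ne_of_gt ht).mul
        (h.continuousOn_snd.mono hsub)).neg.sub (continuousOn_id.mul (hv.mono hsub))).sub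
        (hw.mono hsub))
    have h2 := h1.continuousAt (Ioi_mem_nhds hr0)
    refine (h2.congr ?_).continuousWithinAt
    filter_upwards [Ioi_mem_nhds hr0] with t ht
    rw [profileRate, if_neg (ne_of_gt ht)]

end IsProfile

theorem contDiffOn_one_Ici_of_hasDerivAt {f f' : ℝ → ℝ}
    (h0 : HasDerivWithinAt f (f' 0) (Ici 0) 0) (h : ∀ r, 0 < r → HasDerivAt f (f' r) r)
    (hf' : ContinuousOn f' (Ici 0)) :
    ContDiffOn ℝ 1 f (Ici 0) ∧ ∀ r ∈ Ici (0 : ℝ), derivWithin f (Ici 0) r = f' r := by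
  have hd : ∀ r ∈ Ici (0 : ℝ), HasDerivWithinAt f (f' r) (Ici 0) r := by
    intro r hr
    rcases (mem_Ici.1 hr).eq_or_lt with rfl | hr0
    · exact h0
    · exact (h r hr0).hasDerivWithinAt
  have hd' : ∀ r ∈ Ici (0 : ℝ), derivWithin f (Ici 0) r = f' r := fun r hr =>
    (hd r hr).derivWithin (uniqueDiffOn_Ici 0 r hr)
  refine ⟨(contDiffOn_one_iff_derivWithin (uniqueDiffOn_Ici 0)).2
    ⟨fun r hr => (hd r hr).differentiableWithinAt, hf'.congr hd'⟩, hd'⟩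

theorem IsProfile.isGlobalSolution {N : ℕ} {p s q α a : ℝ} {w v : ℝ → ℝ} (hN : 1 ≤ N)
    (hs : 1 < s) (hps : (p - 1) * (s - 1) = 1) (hq : 1 < q) (h : IsProfile N s q α a w v) :
    IsGlobalSolution N p q α a w ∧
      ∀ r ∈ Ici (0 : ℝ), phiP p (derivWithin w (Ici 0) r) = v r := by
  have hn : (1 : ℝ) ≤ N := by exact_mod_cast hN
  obtain ⟨hwC, hw'⟩ := contDiffOn_one_Ici_of_hasDerivAt (f' := fun r => phiP s (v r))
    (h.hasDerivWithinAt_fst hs le_rfl) h.hasDerivAt_fst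
    ((continuous_phiP hs).comp_continuousOn h.continuousOn_snd)
  obtain ⟨hvC, hv'⟩ := contDiffOn_one_Ici_of_hasDerivAt
    (f' := fun r => profileRate N s q α a r (w r) (v r)) (h.hasDerivWithinAt_snd le_rfl)
    (fun r hr => by simpa [profileRate, hr.ne'] using h.hasDerivAt_snd r hr)
    (h.continuousOn_profileRate hn hs hq)
  have hφ : ∀ r ∈ Ici (0 : ℝ), phiP p (derivWithin w (Ici 0) r) = v r := fun r hr => by
    rw [hw' r hr, phiP_phiP hs hps]
  refine ⟨⟨hwC, hvC.congr hφ, fun r hr => ?_, h.fst_zero, ?_⟩, hφ⟩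
  · have hr' : r ∈ Ici (0 : ℝ) := Ioi_subset_Ici_self hr
    rw [derivWithin_congr hφ (hφ r hr'), hv' r hr', hφ r hr', hw' r hr', profileRate,
      if_neg (ne_of_gt hr), reaction, phiP_add_one]
    ring
  · rw [hw' 0 self_mem_Ici, h.snd_zero, phiP_zero]

theorem IsGlobalSolution.isProfile {N : ℕ} {p s q α a : ℝ} {w : ℝ → ℝ} (hN : 1 ≤ N)
    (hp : 1 < p) (hps : (p - 1) * (s - 1) = 1) (hq : 1 < q) (h : IsGlobalSolution N p q α a w) :
    IsProfile N s q α a w fun r => phiP p (derivWithin w (Ici 0) r) := by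
  obtain ⟨hw, hv, hode, hw0, hw0'⟩ := h
  have hn : (N : ℝ) ≠ 0 := by
    have : (1 : ℝ) ≤ N := by exact_mod_cast hN
    positivity
  set v := fun r => phiP p (derivWithin w (Ici 0) r) with hvdef
  have hψ : ∀ r, phiP s (v r) = derivWithin w (Ici 0) r := fun r =>
    phiP_phiP hp (by rw [mul_comm]; exact hps) _
  have hv0 : v 0 = 0 := by simp only [hvdef, hw0', phiP_zero]
  have hrate : ∀ r, 0 < r → derivWithin v (Ici 0) r
      = -((N - 1) / r * v r) - r * phiP s (v r) - reaction q α (w r) := by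
    intro r hr
    rw [hψ, reaction, phiP_add_one]
    have := hode r hr
    linarith
  have hvd : ∀ r ∈ Ici (0 : ℝ), HasDerivWithinAt v (derivWithin v (Ici 0) r) (Ici 0) r :=
    fun r hr => (hv.differentiableOn one_ne_zero r hr).hasDerivWithinAt
  have hv'c : ContinuousOn (derivWithin v (Ici 0)) (Ici 0) :=
    hv.continuousOn_derivWithin (uniqueDiffOn_Ici 0) le_rfl
  have hsub := Ioi_subset_Ici_self (a := (0 : ℝ))
  have hzero : derivWithin v (Ici 0) 0 = -(reaction q α a / N) := by
    have h1 : Tendsto (fun r => v r / r) (𝓝[>] 0) (𝓝 (derivWithin v (Ici 0) 0)) := by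
      have h1 := (hasDerivWithinAt_iff_tendsto_slope' self_notMem_Ioi).1
        (hvd 0 self_mem_Ici).Ioi_of_Ici
      refine h1.congr fun r => ?_
      rw [slope_def_field, hv0, sub_zero, sub_zero]
    have h2 : Tendsto (fun r => r * derivWithin w (Ici 0) r) (𝓝[>] 0)
        (𝓝 (0 * derivWithin w (Ici 0) 0)) :=
      (tendsto_id.mono_left nhdsWithin_le_nhds).mul
        ((hw.continuousOn_derivWithin (uniqueDiffOn_Ici 0) le_rfl 0 self_mem_Ici).mono hsub)
    have h3 : Tendsto (fun r => reaction q α (w r)) (𝓝[>] 0) (𝓝 (reaction q α (w 0))) :=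
      ((continuous_reaction hq α).tendsto _).comp ((hw.continuousOn 0 self_mem_Ici).mono hsub)
    have h4 := ((h1.const_mul ((N : ℝ) - 1)).neg.sub h2).sub h3
    have h5 : Tendsto (derivWithin v (Ici 0)) (𝓝[>] 0) (𝓝 (derivWithin v (Ici 0) 0)) :=
      (hv'c 0 self_mem_Ici).mono hsub
    have h6 := tendsto_nhds_unique h5 (h4.congr' (by
      filter_upwards [self_mem_nhdsWithin] with r hr
      rw [hrate r hr, hψ]
      ring))
    rw [hw0] at h6
    field_simp
    linarith
  refine ⟨hw.continuousOn, hv.continuousOn, hw0, hv0, fun r hr => ?_, fun r hr => ?_, ?_⟩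
  · rw [hψ]
    exact ((hw.differentiableOn one_ne_zero r hr.le).hasDerivWithinAt).hasDerivAt (Ici_mem_nhds hr)
  · rw [← hrate r hr]
    exact (hvd r hr.le).hasDerivAt (Ici_mem_nhds hr)
  · rw [← hzero]
    exact hvd 0 self_mem_Ici

theorem exists_clipped_profile (N : ℕ) {s : ℝ} (hs : 1 < s) (a : ℝ) {h c : ℝ → ℝ} {B : ℝ}
    (hh : Continuous h) (hc : Continuous c) (hhB : ∀ x, |h x| ≤ B) (hcB : ∀ x, |c x| ≤ B) :
    ∃ w : ℝ → ℝ, Continuous w ∧ ∀ r, 0 ≤ r → w r = a + ∫ t in (0 : ℝ)..r,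
      phiP s (t * ((∫ u in (0 : ℝ)..1, u ^ (N - 1) * h (w (t * u))) - c (w t))) := by
  have hI : ∀ (x : ℝ → ℝ) t, |∫ u in (0 : ℝ)..1, u ^ (N - 1) * h (x (t * u))| ≤ B := by
    intro x t
    have h1 := intervalIntegral.norm_integral_le_of_norm_le_const (a := 0) (b := 1) (C := B)
      (f := fun u : ℝ => u ^ (N - 1) * h (x (t * u))) fun u hu => by
        rw [uIoc_of_le zero_le_one] at hu
        rw [norm_mul, Real.norm_eq_abs, Real.norm_eq_abs, abs_of_nonneg (pow_nonneg hu.1.le _)]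
        exact (mul_le_of_le_one_left (abs_nonneg _) (pow_le_one₀ hu.1.le hu.2)).trans (hhB _)
    simpa using h1
  refine exists_causal_integral_solution (fun x t =>
    phiP s (t * ((∫ u in (0 : ℝ)..1, u ^ (N - 1) * h (x (t * u))) - c (x t)))) a
    (fun R => (R * (B + B)) ^ (s - 1)) ?_ ?_ ?_ ?_
  · intro x hx
    have h1 : Continuous fun t => ∫ u in (0 : ℝ)..1, u ^ (N - 1) * h (x (t * u)) :=
      intervalIntegral.continuous_parametric_intervalIntegral_of_continuous'
        (f := fun t u => u ^ (N - 1) * h (x (t * u))) (by fun_prop) 0 1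
    exact (continuous_phiP hs).comp (continuous_id.mul (h1.sub (hc.comp hx)))
  · intro x y r hr hxy
    simp only [hxy r ⟨hr, le_rfl⟩]
    congr 3
    refine intervalIntegral.integral_congr fun u hu => ?_
    rw [uIcc_of_le zero_le_one] at hu
    simp only [hxy (r * u) ⟨mul_nonneg hr hu.1, mul_le_of_le_one_right hr hu.2⟩]
  · intro R x t _ ht htR
    rw [abs_phiP hs, abs_mul, abs_of_nonneg ht]
    have hB : 0 ≤ B := (abs_nonneg _).trans (hhB 0)
    have hs' : 0 ≤ s - 1 := by linarith
    have hR : 0 ≤ R := ht.trans htR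
    gcongr
    exact (abs_sub _ _).trans (add_le_add (hI x t) (hcB _))
  · intro x y hx hy hlim t _
    refine ((continuous_phiP hs).tendsto _).comp (Tendsto.const_mul t (Tendsto.sub ?_
      ((hc.tendsto _).comp (hlim t))))
    refine intervalIntegral.tendsto_integral_filter_of_dominated_convergence (fun _ => B) ?_ ?_
      intervalIntegrable_const ?_
    · refine Eventually.of_forall fun n => Continuous.aestronglyMeasurable ?_
      have := hx n
      fun_prop
    · refine Eventually.of_forall fun n => Eventually.of_forall fun u hu => ?_
      rw [uIoc_of_le zero_le_one] at hu
      rw [norm_mul, Real.norm_eq_abs, Real.norm_eq_abs, abs_of_nonneg (pow_nonneg hu.1.le _)]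
      exact (mul_le_of_le_one_left (abs_nonneg _) (pow_le_one₀ hu.1.le hu.2)).trans (hhB _)
    · refine Eventually.of_forall fun u _ => ?_
      exact ((hh.tendsto _).comp (hlim (t * u))).const_mul _

/-- The averaged form of `v` satisfies the differential equation for `v`. -/
theorem hasDerivAt_radial_average {N : ℕ} (hN : 1 ≤ N) {g w : ℝ → ℝ} (hg : Continuous g) {r d : ℝ}
    (hr : 0 < r) (hw : HasDerivAt w d r) :
    HasDerivAt (fun t => t * ((∫ u in (0 : ℝ)..1, u ^ (N - 1) * g (t * u)) - w t))
      (-((N - 1) * ((∫ u in (0 : ℝ)..1, u ^ (N - 1) * g (r * u)) - w r)) - r * d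
        + (g r - N * w r)) r := by
  obtain ⟨k, rfl⟩ : ∃ k, N = k + 1 := ⟨N - 1, by omega⟩
  simp only [Nat.add_sub_cancel]
  set J : ℝ → ℝ := fun t => ∫ u in (0 : ℝ)..t, u ^ k * g u
  have hJeq : ∀ t, 0 < t → ∫ u in (0 : ℝ)..1, u ^ k * g (t * u) = J t / t ^ (k + 1) := by
    intro t ht
    have h1 := intervalIntegral.mul_integral_comp_mul_left (a := 0) (b := 1)
      (f := fun u => u ^ k * g u) t
    simp only [mul_zero, mul_one, mul_pow, mul_assoc] at h1
    rw [intervalIntegral.integral_const_mul] at h1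
    rw [show J t = _ from h1.symm]
    field_simp
    ring
  have hJ' : HasDerivAt J (r ^ k * g r) r :=
    (((continuous_id.pow k).mul hg).integral_hasStrictDerivAt 0 r).hasDerivAt
  have hpow : HasDerivAt (fun t : ℝ => t ^ (k + 1)) (((k + 1 : ℕ) : ℝ) * r ^ k) r :=
    hasDerivAt_pow (k + 1) r
  have hmain := (hasDerivAt_id r).mul ((hJ'.div hpow (by positivity)).sub hw)
  have heq : (fun t => t * ((∫ u in (0 : ℝ)..1, u ^ k * g (t * u)) - w t)) =ᶠ[𝓝 r]
      id * (J / (fun t => t ^ (k + 1)) - w) := by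
    filter_upwards [Ioi_mem_nhds hr] with t ht
    simp [hJeq t ht]
  refine (hmain.congr_of_eventuallyEq heq).congr_deriv ?_
  rw [hJeq r hr]
  simp only [id, Pi.sub_apply, Pi.div_apply]
  push_cast
  field_simp
  ring

theorem abs_le_of_first_exit {w : ℝ → ℝ} (hw : Continuous w) {a m : ℝ} (ha : a < m)
    (h : ∀ R, 0 ≤ R → (∀ r ∈ Ico 0 R, |w r| < m) → |w R| ≤ a) : ∀ r, 0 ≤ r → |w r| ≤ a := by
  have hlt : ∀ r, 0 ≤ r → |w r| < m := by
    by_contra! hcon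
    set S := {r : ℝ | 0 ≤ r ∧ m ≤ |w r|} with hS
    have hSne : S.Nonempty := hcon
    have hSbdd : BddBelow S := ⟨0, fun r hr => hr.1⟩
    have hSc : IsClosed S :=
      (isClosed_le continuous_const continuous_id).inter (isClosed_le continuous_const hw.abs)
    have hmem := hSc.csInf_mem hSne hSbdd
    have h1 := h (sInf S) hmem.1 fun r hr => by
      by_contra! hle
      exact absurd (csInf_le hSbdd ⟨hr.1, hle⟩) (not_le.2 hr.2)
    linarith [hmem.2]
  exact fun r hr => h r hr fun t ht => hlt t ht.1

theorem exists_isProfile {N : ℕ} (hN : 1 ≤ N) {s q α : ℝ} (hs : 1 < s) (hq : 1 < q) (hα : 0 < α)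
    (a : ℝ) : ∃ w v : ℝ → ℝ, IsProfile N s q α a w v := by
  have hn : (1 : ℝ) ≤ N := by exact_mod_cast hN
  have hn0 : (N : ℝ) ≠ 0 := by positivity
  set M := |a| + 1 with hM
  have hM0 : 0 ≤ M := by positivity
  let c : ℝ → ℝ := fun x => max (-M) (min M x)
  have hc : Continuous c := by fun_prop
  have hcM : ∀ x, c x ∈ Icc (-M) M := fun x =>
    ⟨le_max_left _ _, max_le (by linarith) (min_le_left _ _)⟩
  have hc_eq : ∀ x, |x| ≤ M → c x = x := fun x hx => by
    simp only [c]
    rw [min_eq_right (abs_le.1 hx).2, max_eq_right (abs_le.1 hx).1]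
  let h : ℝ → ℝ := fun x => N * c x - reaction q α (c x)
  have hh : Continuous h := (continuous_const.mul hc).sub ((continuous_reaction hq α).comp hc)
  obtain ⟨B, hB⟩ := (isCompact_Icc (a := -M) (b := M)).exists_bound_of_continuousOn
    (f := fun x => N * x - reaction q α x)
    ((continuous_const.mul continuous_id).sub (continuous_reaction hq α)).continuousOn
  obtain ⟨w₀, hw₀, hfix⟩ := exists_clipped_profile N hs a (B := max B M) hh hc
    (fun x => (hB _ (hcM x)).trans (le_max_left _ _))
    (fun x => (abs_le.2 (hcM x)).trans (le_max_right _ _))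
  set k : ℝ → ℝ := fun t => (∫ u in (0 : ℝ)..1, u ^ (N - 1) * h (w₀ (t * u))) - c (w₀ t) with hk
  have hkc : Continuous k :=
    (intervalIntegral.continuous_parametric_intervalIntegral_of_continuous'
      (f := fun t u => u ^ (N - 1) * h (w₀ (t * u))) (by fun_prop) 0 1).sub (hc.comp hw₀)
  set v : ℝ → ℝ := fun t => t * k t with hv
  have hvc : Continuous v := continuous_id.mul hkc
  have hψc : Continuous fun t => phiP s (v t) := (continuous_phiP hs).comp hvc
  have hw₀0 : w₀ 0 = a := by simpa using hfix 0 le_rfl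
  have hv0 : v 0 = 0 := by simp [hv]
  have hw' : ∀ r, 0 < r → HasDerivAt w₀ (phiP s (v r)) r := by
    intro r hr
    refine ((hψc.integral_hasStrictDerivAt 0 r).hasDerivAt.const_add a).congr_of_eventuallyEq ?_
    filter_upwards [Ioi_mem_nhds hr] with t ht
    exact hfix t (le_of_lt ht)
  have hv' : ∀ r, 0 < r → |w₀ r| < M →
      HasDerivAt v (-((N - 1) / r * v r) - r * phiP s (v r) - reaction q α (w₀ r)) r := by
    intro r hr hrM
    have hnear : (fun t => c (w₀ t)) =ᶠ[𝓝 r] w₀ := by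
      filter_upwards [hw₀.abs.continuousAt.eventually (gt_mem_nhds hrM)] with t ht
      exact hc_eq _ (le_of_lt ht)
    have hcw : HasDerivAt (fun t => c (w₀ t)) (phiP s (v r)) r :=
      (hw' r hr).congr_of_eventuallyEq hnear
    refine (hasDerivAt_radial_average hN (hh.comp hw₀) hr hcw).congr_deriv ?_
    have hvr : (N - 1) / r * v r = (N - 1) * k r := by
      simp only [hv]; field_simp
    rw [hvr]
    simp only [hk, h, Function.comp_apply, hc_eq _ hrM.le]
    ring
  have hbound : ∀ r, 0 ≤ r → |w₀ r| ≤ |a| := by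
    refine abs_le_of_first_exit hw₀ (show |a| < M by linarith) fun R hR hlt => ?_
    have hE := energy_antitoneOn hn hs hq le_rfl hw₀.continuousOn hvc.continuousOn
      (fun r hr => hw' r hr.1) (fun r hr => hv' r hr.1 (hlt r ⟨hr.1.le, hr.2⟩))
      (left_mem_Icc.2 hR) (right_mem_Icc.2 hR) hR
    simp only [hw₀0, hv0] at hE
    exact abs_le_of_energy_le hs hq hα hE
  refine ⟨w₀, v, hw₀.continuousOn, hvc.continuousOn, hw₀0, hv0, hw', fun r hr =>
    hv' r hr ((hbound r hr.le).trans_lt (by linarith)), ?_⟩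
  have hk0 : k 0 = -(reaction q α a / N) := by
    have hca : c a = a := hc_eq a (by linarith)
    obtain ⟨j, rfl⟩ : ∃ j, N = j + 1 := ⟨N - 1, by omega⟩
    simp only [hk, zero_mul, hw₀0, h, hca, Nat.add_sub_cancel]
    rw [intervalIntegral.integral_mul_const, integral_pow]
    push_cast at hn0 ⊢
    field_simp
    simp
  refine HasDerivAt.hasDerivWithinAt ?_
  rw [hasDerivAt_iff_tendsto_slope, ← hk0]
  refine (hkc.continuousAt.tendsto.mono_left nhdsWithin_le_nhds).congr' ?_
  filter_upwards [self_mem_nhdsWithin] with t ht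
  rw [slope_def_field, hv0, sub_zero, sub_zero, hv, mul_div_cancel_left₀ _ ht]

/-- For any `a ≠ 0`, the initial value problem for (E) with `w(0) = a`, `w'(0) = 0`
admits a unique global solution `w ∈ C¹([0,∞))` with `|w'|^{p-2}w' ∈ C¹([0,∞))`;
moreover `lim_{r→0⁺} |w'(r)|^{p-2}w'(r)/r = -(|a|^{q-1}a + α a)/N` and `|w(r)| ≤ |a|`. -/
theorem stmt0 (N : ℕ) (hN : 1 ≤ N) (p q α : ℝ) (hp : 1 < p) (hq : 1 < q) (hα : 0 < α)
    (a : ℝ) (ha : a ≠ 0) :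
    (∃ w : ℝ → ℝ, IsGlobalSolution N p q α a w ∧
      Tendsto (fun r => phiP p (derivWithin w (Ici 0) r) / r) (𝓝[>] (0 : ℝ))
        (𝓝 (-((|a| ^ (q - 1) * a + α * a) / N))) ∧
      ∀ r ∈ Ici (0 : ℝ), |w r| ≤ |a|) ∧
    ∀ w₁ w₂ : ℝ → ℝ, IsGlobalSolution N p q α a w₁ → IsGlobalSolution N p q α a w₂ →
      ∀ r ∈ Ici (0 : ℝ), w₁ r = w₂ r := by
  obtain ⟨s, hs, hps⟩ : ∃ s : ℝ, 1 < s ∧ (p - 1) * (s - 1) = 1 := by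
    have : 0 < p - 1 := by linarith
    refine ⟨1 + 1 / (p - 1), by simpa using this, ?_⟩
    rw [add_sub_cancel_left, mul_one_div_cancel this.ne']
  have hn : (1 : ℝ) ≤ N := by exact_mod_cast hN
  refine ⟨?_, fun w₁ w₂ h₁ h₂ r hr =>
    (h₁.isProfile hN hp hps hq).eq (h₂.isProfile hN hp hps hq) hn hs hq hα ha hr⟩
  obtain ⟨w, v, h⟩ := exists_isProfile hN hs hq hα a
  obtain ⟨hw, hv⟩ := h.isGlobalSolution hN hs hps hq
  refine ⟨w, hw, ?_, fun r hr => h.abs_fst_le hn hs hq hα hr⟩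
  rw [← phiP_add_one, add_comm (phiP (q + 1) a)]
  refine h.tendsto_snd_div.congr' ?_
  filter_upwards [self_mem_nhdsWithin] with r hr
  rw [hv r (Ioi_subset_Ici_self hr)]
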